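/- Let (a_K)_K be a family indexed by the CM subfields K of ℂ of finite degree over ℚ, where a_K ∈ K^× is a nonzero element of K, and suppose the family is norm-compatible: whenever K ⊆ L are two such fields, the field norm Nm_{L/K}(a_L) = a_K. Then a_K = 1 for every K. (Equivalently, the inverse limit over CM fields of the multiplicative groups K^× under the norm maps is trivial.) -/

import Mathlib

set_option synthInstance.maxHeartbeats 400000
open NumberField IntermediateField

/-- A subfield of `ℂ` is totally real if every field embedding of it into `ℂ`
has image contained in `ℝ`. -/
def TotallyReal (F : IntermediateField ℚ ℂ) : Prop :=
  ∀ φ : F →+* ℂ, ∀ x : F, (φ x).im = 0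

/-- A subfield of `ℂ` is a CM field if it is totally imaginary (no embedding into `ℂ`
lands in `ℝ`) and is a quadratic extension of a totally real subfield. -/
def IsCM (K : IntermediateField ℚ ℂ) : Prop :=
  (∀ φ : K →+* ℂ, ∃ x : K, (φ x).im ≠ 0) ∧
  ∃ (Kp : IntermediateField ℚ ℂ) (h : Kp ≤ K), TotallyReal Kp ∧
    (letI : Algebra Kp K := (IntermediateField.inclusion h).toRingHom.toAlgebra
     Module.finrank Kp K = 2)

/-- The field norm `Nm_{L/K} : L → K` for subfields `K ⊆ L` of `ℂ`. -/
noncomputable def fieldNorm (K L : IntermediateField ℚ ℂ) (h : K ≤ L) (x : L) : K :=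
  letI : Algebra K L := (IntermediateField.inclusion h).toRingHom.toAlgebra
  Algebra.norm K x

section PartA
open Polynomial

lemma dk_coeffs (k : ℕ) :
    (dickson 1 (1:ℤ) (2*k)).coeff 0 = 2 * (-1)^k ∧ (dickson 1 (1:ℤ) (2*k+1)).coeff 0 = 0 ∧
    (dickson 1 (1:ℤ) (2*k+1)).coeff 1 = (-1)^k * (2*k+1) := by
  induction k with
  | zero => 
    refine ⟨?_, ?_, ?_⟩
    · simp [dickson_zero]; try norm_num
    · simp
    · simp
  | succ k ih =>
    obtain ⟨h1, h2, h3⟩ := ih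
    have e1 : dickson 1 (1:ℤ) (2*(k+1)) = X * dickson 1 1 (2*k+1) - dickson 1 1 (2*k) := by
      have := dickson_add_two 1 (1:ℤ) (2*k)
      rw [map_one, one_mul] at this
      exact this
    have e2 : dickson 1 (1:ℤ) (2*(k+1)+1) = X * dickson 1 1 (2*(k+1)) - dickson 1 1 (2*k+1) := by
      have := dickson_add_two 1 (1:ℤ) (2*k+1)
      rw [map_one, one_mul] at this
      exact this
    have c0 : (dickson 1 (1:ℤ) (2*(k+1))).coeff 0 = 2 * (-1)^(k+1) := by
      rw [e1, coeff_sub, coeff_X_mul_zero, h1]; ring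
    refine ⟨c0, ?_, ?_⟩
    · rw [e2, coeff_sub, coeff_X_mul_zero, h2]; ring
    · rw [e2, coeff_sub, show (1:ℕ) = 0 + 1 from rfl, coeff_X_mul, c0, zero_add, h3]; push_cast; ring

lemma dk_monic (k : ℕ) : ((dickson 1 (1:ℤ) (k+1)).Monic ∧ (dickson 1 (1:ℤ) (k+1)).natDegree = k+1) ∧
   ((dickson 1 (1:ℤ) (k+2)).Monic ∧ (dickson 1 (1:ℤ) (k+2)).natDegree = k+2) := by
  induction k with
  | zero =>
    refine ⟨⟨?_, ?_⟩, ?_⟩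
    · simp
    · simp
    · have : dickson 1 (1:ℤ) 2 = X^2 - C 2 := by
        rw [dickson_two]; simp; norm_num
      rw [zero_add, this]
      exact ⟨monic_X_pow_sub_C _ (by norm_num), natDegree_X_pow_sub_C⟩
  | succ k ih =>
    obtain ⟨⟨h1, h2⟩, h3, h4⟩ := ih
    refine ⟨⟨h3, h4⟩, ?_⟩
    have e : dickson 1 (1:ℤ) (k+1+2) = X * dickson 1 1 (k+2) - dickson 1 1 (k+1) := by
      have := dickson_add_two 1 (1:ℤ) (k+1)
      rw [map_one, one_mul] at this
      exact this
    have m : (X * dickson 1 (1:ℤ) (k+2)).Monic := monic_X.mul h3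
    have d : (X * dickson 1 (1:ℤ) (k+2)).natDegree = k+3 := by
      rw [natDegree_X_mul h3.ne_zero, h4]
    have lt : (dickson 1 (1:ℤ) (k+1)).degree < (X * dickson 1 (1:ℤ) (k+2)).degree := by
      apply degree_lt_degree; rw [d, h2]; omega
    rw [e]
    refine ⟨m.sub_of_left lt, ?_⟩
    rw [natDegree_sub_eq_left_of_natDegree_lt (by rw [d, h2]; omega), d]

lemma exists_h (p : ℕ) [hp : Fact p.Prime] (hp2 : p ≠ 2) : ∃ h : ℤ[X], h.Monic ∧ h.natDegree = p - 1 ∧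
    h.map (Int.castRingHom (ZMod p)) = X ^ (p-1) ∧ (h.coeff 0 = p ∨ h.coeff 0 = -p) ∧
    ∀ z : ℂ, aeval z h = 0 → z.im = 0 := by
  obtain ⟨k, hk⟩ := hp.out.odd_of_ne_two hp2
  obtain ⟨-, c0, c1⟩ := dk_coeffs k
  rw [← hk] at c0 c1
  have hm := (dk_monic (2*k)).1
  rw [← hk] at hm
  have e : dickson 1 (1:ℤ) p = X * (dickson 1 (1:ℤ) p).divX := by
    conv_lhs => rw [← X_mul_divX_add (dickson 1 (1:ℤ) p), c0]
    simp
  set h := (dickson 1 (1:ℤ) p).divX with hh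
  have hmon : h.Monic := by
    have := hm.1
    rw [e] at this
    exact monic_X.of_mul_monic_left this
  refine ⟨h, hmon, ?_, ?_, ?_, ?_⟩
  · have := hm.2
    rw [e, natDegree_X_mul hmon.ne_zero] at this
    omega
  · have := congrArg (map (Int.castRingHom (ZMod p))) e
    rw [map_dickson, map_one, dickson_one_one_zmod_p, Polynomial.map_mul, map_X] at this
    have hpp : X ^ p = (X : (ZMod p)[X]) * X^(p-1) := by
      rw [← pow_succ']; congr 1; have := hp.out.pos; omega
    rw [hpp] at this
    exact (mul_left_cancel₀ X_ne_zero this).symm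
  · rw [hh, coeff_divX, zero_add, c1, hk]
    rcases neg_one_pow_eq_or ℤ k with h | h <;> rw [h]
    · left; push_cast; ring
    · right; push_cast; ring
  · intro z hz
    obtain ⟨w, hw⟩ : ∃ w : ℂ, w * w - z * w + 1 = 0 := by
      obtain ⟨w, hw⟩ := IsAlgClosed.exists_eval₂_eq_zero (RingHom.id ℂ) (X^2 - C z * X + 1 : ℂ[X])
        (by 
          have : (X^2 - C z * X + 1 : ℂ[X]).degree = 2 := by compute_degree!
          rw [this]; norm_num)
      refine ⟨w, ?_⟩
      simp at hw
      linear_combination hw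
    have w0 : w ≠ 0 := by rintro rfl; simp at hw
    have hzw : z = w + w⁻¹ := by field_simp; linear_combination -hw
    have hd : (dickson 1 (1:ℂ) p).eval z = 0 := by
      have : dickson 1 (1:ℂ) p = (dickson 1 (1:ℤ) p).map (algebraMap ℤ ℂ) := by
        rw [map_dickson]; simp
      rw [this, e, eval_map_algebraMap, map_mul, hz, mul_zero]
    rw [hzw, dickson_one_one_eval_add_inv _ _ (mul_inv_cancel₀ w0)] at hd
    have hn : ‖w‖ = 1 := by
      have h1 : w ^ (2*p) = -1 := by
        have : w^p ≠ 0 := pow_ne_zero _ w0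
        rw [inv_pow] at hd
        field_simp at hd
        rw [mul_comm 2 p, pow_mul]
        linear_combination hd
      have h2 : ‖w‖^(2*p) = 1 := by rw [← norm_pow, h1]; simp
      exact (pow_eq_one_iff_of_nonneg (norm_nonneg _) (by have := hp.out.pos; omega)).1 h2
    rw [hzw, Complex.inv_eq_conj hn]
    simp
end PartA
section PartB
open Polynomial

lemma det_nil {F : Type*} [Field F] (n : ℕ) (M : Matrix (Fin n) (Fin n) F) (hM : M ^ n = 0) (q : F[X]) :
    (aeval M q).det = (q.coeff 0) ^ n := by
  have e : aeval M q = Matrix.scalar (Fin n) (q.coeff 0) - (-(M * aeval M q.divX)) := by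
    conv_lhs => rw [← X_mul_divX_add q]
    rw [map_add, map_mul, aeval_X, aeval_C, sub_neg_eq_add, add_comm]
    rfl
  have hc : Commute M (aeval M q.divX) := by
    have : Commute (aeval M (X : F[X])) (aeval M q.divX) := by
      unfold Commute SemiconjBy
      rw [← map_mul, mul_comm, map_mul]
    simpa using this
  have hnil : IsNilpotent (-(M * aeval M q.divX)) := by
    apply IsNilpotent.neg
    exact hc.isNilpotent_mul_right ⟨n, hM⟩
  have h2 := Matrix.isNilpotent_charpoly_sub_pow_of_isNilpotent hnil
  have h3 := sub_eq_zero.1 h2.eq_zero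
  rw [e, ← Matrix.eval_charpoly, h3]
  simp

lemma det_form (p : ℕ) [hp : Fact p.Prime] (M : Matrix (Fin (p-1)) (Fin (p-1)) ℤ_[p])
    (hmod : M.charpoly.map PadicInt.toZMod = X ^ (p-1))
    (h0 : M.charpoly.coeff 0 = p ∨ M.charpoly.coeff 0 = -p) (N : ℕ) :
    ∀ q : ℤ_[p][X], ¬ (p : ℤ_[p]) ^ N ∣ (aeval M q).det →
      ∃ (k : ℕ) (w : ℤ_[p]), (aeval M q).det = M.det ^ k * w ∧ PadicInt.toZMod w = 1 := by
  have hred (q : ℤ_[p][X]) : PadicInt.toZMod (aeval M q).det = (PadicInt.toZMod (q.coeff 0)) ^ (p-1) := by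
    have h1 : (M.map PadicInt.toZMod) ^ (p-1) = 0 := by
      have := Matrix.aeval_self_charpoly (M.map PadicInt.toZMod)
      rw [Matrix.charpoly_map, hmod] at this
      simpa using this
    have := det_nil (p-1) (M.map PadicInt.toZMod) h1 (q.map PadicInt.toZMod)
    rw [coeff_map] at this
    rw [← this, RingHom.map_det]
    congr 1
    have e2 := Polynomial.map_aeval_eq_aeval_map (S := Matrix (Fin (p-1)) (Fin (p-1)) ℤ_[p])
      (T := ZMod p) (U := Matrix (Fin (p-1)) (Fin (p-1)) (ZMod p)) (φ := PadicInt.toZMod)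
      (ψ := PadicInt.toZMod.mapMatrix) ?_ q M
    · exact e2
    · ext x i j
      by_cases hij : i = j <;> simp [Matrix.algebraMap_matrix_apply, hij]
  have hdet : ∃ e : ℤ_[p], IsUnit e ∧ M.det = e * p := by
    rw [Matrix.det_eq_sign_charpoly_coeff]
    rcases h0 with h0 | h0
    · exact ⟨(-1) ^ Fintype.card (Fin (p-1)), (isUnit_one.neg).pow _, by rw [h0]⟩
    · exact ⟨(-1) ^ Fintype.card (Fin (p-1)) * (-1), ((isUnit_one.neg).pow _).mul isUnit_one.neg, by rw [h0]; ring⟩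
  induction N with
  | zero => intro q hq; simp at hq
  | succ N ih =>
    intro q hq
    by_cases hz : PadicInt.toZMod (q.coeff 0) = 0
    · have hc : ∃ c, q.coeff 0 = M.charpoly.coeff 0 * c := by
        have hm : q.coeff 0 ∈ RingHom.ker (PadicInt.toZMod (p := p)) := hz
        rw [PadicInt.ker_toZMod, PadicInt.maximalIdeal_eq_span_p, Ideal.mem_span_singleton] at hm
        obtain ⟨c, hc⟩ := hm
        rcases h0 with h0 | h0
        · exact ⟨c, by rw [h0, hc]⟩
        · exact ⟨-c, by rw [h0, hc]; ring⟩
      obtain ⟨c, hc⟩ := hc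
      have e : q = X * (q.divX - C c * M.charpoly.divX) + C c * M.charpoly := by
        conv_lhs => rw [← X_mul_divX_add q]
        conv_rhs => rw [← X_mul_divX_add M.charpoly]
        rw [hc, C_mul]
        simp only [X_mul_divX_add]
        have := X_mul_divX_add M.charpoly
        linear_combination (C c) * this
      set q' := q.divX - C c * M.charpoly.divX
      have hD : (aeval M q).det = M.det * (aeval M q').det := by
        rw [e, map_add, map_mul, map_mul, Matrix.aeval_self_charpoly, mul_zero, add_zero, aeval_X, Matrix.det_mul]
      obtain ⟨k, w, hk, hw⟩ := ih q' (by
        rintro ⟨d, hd⟩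
        obtain ⟨e, he, hM⟩ := hdet
        apply hq
        rw [hD, hd, hM]
        exact ⟨e * d, by ring⟩)
      exact ⟨k+1, w, by rw [hD, hk]; ring, hw⟩
    · exact ⟨0, (aeval M q).det, by simp, by rw [hred]; exact ZMod.pow_card_sub_one_eq_one hz⟩

/-- The key p-adic lemma. -/
lemma det_unit (p : ℕ) [hp : Fact p.Prime] (M : Matrix (Fin (p-1)) (Fin (p-1)) ℤ_[p])
    (hmod : M.charpoly.map PadicInt.toZMod = X ^ (p-1))
    (h0 : M.charpoly.coeff 0 = p ∨ M.charpoly.coeff 0 = -p)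
    (q : ℚ_[p][X]) (hq : ‖(aeval (M.map (algebraMap ℤ_[p] ℚ_[p])) q).det‖ = 1) :
    ‖(aeval (M.map (algebraMap ℤ_[p] ℚ_[p])) q).det - 1‖ < 1 := by
  set y := (aeval (M.map (algebraMap ℤ_[p] ℚ_[p])) q).det
  have hp0 : (p : ℤ_[p]) ≠ 0 := by exact_mod_cast hp.out.ne_zero
  obtain ⟨b, r, hr⟩ : ∃ (b : ℤ_[p]) (r : ℤ_[p][X]), b ≠ 0 ∧ r.map (algebraMap ℤ_[p] ℚ_[p]) = C (b : ℚ_[p]) * q := by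
    obtain ⟨b, hb', hb⟩ := IsLocalization.integerNormalization_spec (nonZeroDivisors ℤ_[p]) q
    refine ⟨b, _, nonZeroDivisors.ne_zero hb', hb.trans ?_⟩
    rw [Algebra.smul_def]
    rfl
  have hD (r : ℤ_[p][X]) : ((aeval M r).det : ℚ_[p]) = (aeval (M.map (algebraMap ℤ_[p] ℚ_[p])) (r.map (algebraMap ℤ_[p] ℚ_[p]))).det := by
    change algebraMap ℤ_[p] ℚ_[p] _ = _
    rw [RingHom.map_det]
    congr 1
    refine Polynomial.map_aeval_eq_aeval_map (S := Matrix (Fin (p-1)) (Fin (p-1)) ℤ_[p])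
      (T := ℚ_[p]) (U := Matrix (Fin (p-1)) (Fin (p-1)) (ℚ_[p])) (φ := algebraMap ℤ_[p] ℚ_[p])
      (ψ := (algebraMap ℤ_[p] ℚ_[p]).mapMatrix) ?_ r M
    ext x i j
    by_cases hij : i = j <;> simp [Matrix.algebraMap_matrix_apply, hij]
  have key (r : ℤ_[p][X]) (hr : (aeval M r).det ≠ 0) : 
      ∃ (k : ℕ) (w : ℤ_[p]), (aeval M r).det = M.det ^ k * w ∧ PadicInt.toZMod w = 1 := by
    obtain ⟨N, hN⟩ : FiniteMultiplicity (p : ℤ_[p]) (aeval M r).det :=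
      FiniteMultiplicity.of_not_isUnit PadicInt.prime_p.not_isUnit hr
    exact det_form p M hmod h0 _ r hN
  have hb : (aeval M (C b)).det = b ^ (p-1) := by
    rw [aeval_C, Matrix.algebraMap_eq_diagonal]
    simp
  have hr' : ((aeval M r).det : ℚ_[p]) = ((aeval M (C b)).det : ℚ_[p]) * y := by
    rw [hD, hr.2, hD, map_mul, Matrix.det_mul, map_C]
    rfl
  have hy0 : y ≠ 0 := by rintro h; rw [h] at hq; simp at hq
  have hb0 : (aeval M (C b)).det ≠ 0 := by rw [hb]; exact pow_ne_zero _ hr.1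
  obtain ⟨k, w, e1, w1⟩ := key (C b) hb0
  obtain ⟨k', w', e2, w2⟩ := key r (by
    intro h; rw [h] at hr'
    have : ((aeval M (C b)).det : ℚ_[p]) ≠ 0 := by rwa [Ne, PadicInt.coe_eq_zero]
    exact mul_ne_zero this hy0 (by rw [← hr']; rfl))
  have nw (w : ℤ_[p]) (hw : PadicInt.toZMod w = 1) : ‖w - 1‖ < 1 := by
    have hm : w - 1 ∈ RingHom.ker (PadicInt.toZMod (p := p)) := by
      rw [RingHom.mem_ker, map_sub, hw, map_one, sub_self]
    rw [PadicInt.ker_toZMod, PadicInt.maximalIdeal_eq_span_p, Ideal.mem_span_singleton] at hm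
    exact (PadicInt.norm_lt_one_iff_dvd _).2 hm
  have nw1 (w : ℤ_[p]) (hw : PadicInt.toZMod w = 1) : ‖w‖ = 1 := by
    by_contra hne
    have hlt : ‖w‖ < 1 := lt_of_le_of_ne (PadicInt.norm_le_one w) hne
    have h3 : ‖(1 : ℤ_[p])‖ < 1 := by
      rw [show (1 : ℤ_[p]) = w + (-(w - 1)) by ring]
      refine (PadicInt.nonarchimedean _ _).trans_lt (max_lt hlt ?_)
      rw [norm_neg]; exact nw w hw
    simp at h3
  have hMn : M.det ≠ 0 ∧ ‖M.det‖ < 1 := by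
    have : ‖M.det‖ = ‖(p:ℤ_[p])‖ := by
      rw [Matrix.det_eq_sign_charpoly_coeff]
      rcases h0 with h0 | h0 <;> simp [h0]
    have h2 := (PadicInt.norm_lt_one_iff_dvd (p : ℤ_[p])).2 dvd_rfl
    refine ⟨?_, by rw [this]; exact h2⟩
    rw [← norm_ne_zero_iff, this, norm_ne_zero_iff]; exact hp0
  have hkk : k' = k := by
    have := congrArg norm hr'
    rw [norm_mul, hq, mul_one, ← PadicInt.norm_def, ← PadicInt.norm_def, e1, e2, norm_mul, norm_mul, nw1 _ w1, nw1 _ w2, norm_pow, norm_pow, mul_one, mul_one] at this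
    exact (pow_right_injective₀ (norm_pos_iff.2 hMn.1) hMn.2.ne) this
  subst hkk
  have hy : (w' : ℚ_[p]) = w * y := by
    rw [e1, e2] at hr'
    push_cast at hr'
    have h3 : (M.det : ℚ_[p]) ^ k' ≠ 0 := pow_ne_zero _ (by rw [Ne, PadicInt.coe_eq_zero]; exact hMn.1)
    apply mul_left_cancel₀ h3
    rw [hr']; ring
  have n1 : ‖(w : ℚ_[p])‖ = 1 := nw1 w w1
  have : ‖y - 1‖ = ‖((w' - w : ℤ_[p]) : ℚ_[p])‖ := by
    rw [PadicInt.coe_sub, hy, show (w : ℚ_[p]) * y - w = w * (y-1) by ring, norm_mul, n1, one_mul]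
  rw [this, ← PadicInt.norm_def, show w' - w = (w' - 1) + (-(w - 1)) by ring]
  refine (PadicInt.nonarchimedean _ _).trans_lt (max_lt (nw _ w2) ?_)
  rw [norm_neg]; exact nw _ w1
end PartB
section PartC
open Polynomial

/-- Companion matrix. -/
def compMat (h : ℤ[X]) (n : ℕ) : Matrix (Fin n) (Fin n) ℤ :=
  Matrix.of fun i j => if (j : ℕ) + 1 = n then -h.coeff i else if (i : ℕ) = j + 1 then 1 else 0

lemma leftMul_eq {K L : Type*} [Field K] [Field L] [Algebra K L] (pb : PowerBasis K L) (h : ℤ[X])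
    (hm : minpoly K pb.gen = h.map (Int.castRingHom K)) :
    Algebra.leftMulMatrix pb.basis pb.gen = (compMat h pb.dim).map (Int.castRingHom K) := by
  rw [PowerBasis.leftMulMatrix, PowerBasis.minpolyGen_eq, hm]
  ext i j
  simp only [compMat, Matrix.of_apply, Matrix.map_apply, coeff_map]
  split_ifs <;> simp

lemma norm_eq_det {K L : Type*} [Field K] [Field L] [Algebra K L] (pb : PowerBasis K L) (h : ℤ[X]) (n : ℕ)
    (hn : pb.dim = n)
    (hm : minpoly K pb.gen = h.map (Int.castRingHom K)) (q : K[X]) :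
    Algebra.norm K (aeval pb.gen q) = (aeval ((compMat h n).map (Int.castRingHom K)) q).det := by
  subst hn
  rw [Algebra.norm_eq_matrix_det pb.basis, ← leftMul_eq pb h hm, aeval_algHom_apply]

lemma charpoly_comp (F : Type*) [Field F] [CharZero F] (h : ℤ[X]) (hmon : h.Monic)
    (hirr : Irreducible (h.map (Int.castRingHom F))) :
    (compMat h h.natDegree).charpoly = h := by
  have := Fact.mk hirr
  apply Polynomial.map_injective (Int.castRingHom F) Int.cast_injective
  rw [← Matrix.charpoly_map]
  have hm : minpoly F (AdjoinRoot.powerBasis hirr.ne_zero).gen = h.map (Int.castRingHom F) := by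
    rw [AdjoinRoot.powerBasis_gen, AdjoinRoot.minpoly_root hirr.ne_zero, (hmon.map _).leadingCoeff]
    simp
  have e := leftMul_eq (AdjoinRoot.powerBasis hirr.ne_zero) h hm
  have hd : (AdjoinRoot.powerBasis hirr.ne_zero).dim = h.natDegree := by
    rw [AdjoinRoot.powerBasis_dim, hmon.natDegree_map]
  have e2 := charpoly_leftMulMatrix (AdjoinRoot.powerBasis hirr.ne_zero)
  rw [e, hm, hd] at e2
  exact e2

lemma h_irred (p : ℕ) [hp : Fact p.Prime] (hp2 : p ≠ 2) (h : ℤ[X]) (hmon : h.Monic) (hdeg : h.natDegree = p - 1)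
    (hmod : h.map (Int.castRingHom (ZMod p)) = X ^ (p-1)) (h0 : h.coeff 0 = p ∨ h.coeff 0 = -p) :
    Irreducible (h.map (Int.castRingHom ℚ_[p])) := by
  have e : h.map (Int.castRingHom ℚ_[p]) = (h.map (Int.castRingHom ℤ_[p])).map (algebraMap ℤ_[p] ℚ_[p]) := by
    rw [Polynomial.map_map]; rfl
  have hm' := hmon.map (Int.castRingHom ℤ_[p])
  have hdeg' : (h.map (Int.castRingHom ℤ_[p])).natDegree = p - 1 := by rw [hmon.natDegree_map, hdeg]
  have hpos : 0 < p - 1 := by have := hp.out.two_le; omega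
  rw [e, ← hm'.irreducible_iff_irreducible_map_fraction_map]
  have hprime : (Ideal.span {(p : ℤ_[p])}).IsPrime := by
    rw [← PadicInt.maximalIdeal_eq_span_p]; infer_instance
  refine IsEisensteinAt.irreducible (𝓟 := Ideal.span {(p : ℤ_[p])}) ?_ hprime hm'.isPrimitive (by rw [hdeg']; exact hpos)
  refine hm'.isEisensteinAt_of_mem_of_notMem hprime.ne_top ?_ ?_
  · intro n hn
    rw [hdeg'] at hn
    have h1 : ((h.coeff n : ℤ) : ZMod p) = 0 := by
      have := congrArg (fun f => coeff f n) hmod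
      simp only [coeff_map, coeff_X_pow, if_neg hn.ne] at this
      simpa using this
    rw [ZMod.intCast_zmod_eq_zero_iff_dvd] at h1
    obtain ⟨c, hc⟩ := h1
    rw [coeff_map, Ideal.mem_span_singleton, hc]
    exact ⟨c, by simp⟩
  · rw [coeff_map, Ideal.span_singleton_pow, Ideal.mem_span_singleton]
    have hps : ¬ (p : ℤ_[p])^2 ∣ (p : ℤ_[p]) := by
      rintro ⟨c, hc⟩
      have hp0 : (p : ℤ_[p]) ≠ 0 := by exact_mod_cast hp.out.ne_zero
      apply (PadicInt.prime_p (p := p)).not_isUnit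
      refine IsUnit.of_mul_eq_one c ?_
      apply mul_left_cancel₀ hp0
      linear_combination -hc
    rcases h0 with h0 | h0 <;> rw [h0]
    · simpa using hps
    · simpa using hps

lemma norm_congr_one {K L : Type*} [Field K] [Field L] [Algebra K L]
    (p : ℕ) [hp : Fact p.Prime] (hp2 : p ≠ 2) (h : ℤ[X]) (hmon : h.Monic) (hdeg : h.natDegree = p - 1)
    (hmod : h.map (Int.castRingHom (ZMod p)) = X ^ (p-1)) (h0 : h.coeff 0 = p ∨ h.coeff 0 = -p)
    (pb : PowerBasis K L) (hroot : minpoly K pb.gen = h.map (Int.castRingHom K)) (ψ : K →+* ℚ_[p])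
    (y : L) (hy : ‖ψ (Algebra.norm K y)‖ = 1) : ‖ψ (Algebra.norm K y) - 1‖ < 1 := by
  have hirr := h_irred p hp2 h hmon hdeg hmod h0
  have hdim : pb.dim = p - 1 := by
    rw [← pb.natDegree_minpoly, hroot, hmon.natDegree_map, hdeg]
  obtain ⟨q, rfl⟩ : ∃ q : K[X], y = aeval pb.gen q := by
    obtain ⟨q, hq⟩ := pb.exists_eq_aeval' y
    exact ⟨q, hq⟩
  have hch := charpoly_comp ℚ_[p] h hmon hirr
  rw [hdeg] at hch
  set M : Matrix (Fin (p-1)) (Fin (p-1)) ℤ_[p] := (compMat h (p-1)).map (Int.castRingHom ℤ_[p]) with hM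
  have hMc : M.charpoly = h.map (Int.castRingHom ℤ_[p]) := by
    rw [hM, Matrix.charpoly_map, hch]
  have e : ψ (Algebra.norm K (aeval pb.gen q)) = (aeval (M.map (algebraMap ℤ_[p] ℚ_[p])) (q.map ψ)).det := by
    rw [norm_eq_det pb h (p-1) hdim hroot, RingHom.map_det]
    congr 1
    have e2 := Polynomial.map_aeval_eq_aeval_map (S := Matrix (Fin (p-1)) (Fin (p-1)) K)
      (T := ℚ_[p]) (U := Matrix (Fin (p-1)) (Fin (p-1)) (ℚ_[p])) (φ := ψ)
      (ψ := ψ.mapMatrix) (by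
        ext x i j
        by_cases hij : i = j <;> simp [Matrix.algebraMap_matrix_apply, hij]) q ((compMat h (p-1)).map (Int.castRingHom K))
    rw [e2]
    congr 2
    ext i j
    simp [hM]
  rw [e] at hy ⊢
  refine det_unit p M ?_ ?_ _ hy
  · rw [hMc, Polynomial.map_map, ← hmod]
    congr 1
    exact RingHom.ext_int _ _
  · rw [hMc, coeff_map]
    rcases h0 with h0 | h0 <;> rw [h0] <;> simp
end PartC
section PartD
open Polynomial

lemma exists_prime_root (f : ℤ[X]) (hf : 0 < f.natDegree) (N : ℕ) :
    ∃ p : ℕ, p.Prime ∧ N < p ∧ ∃ x : ℤ, (p : ℤ) ∣ f.eval x := by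
  by_cases hc : f.coeff 0 = 0
  · obtain ⟨p, hp, hp'⟩ := Nat.exists_infinite_primes (N+1)
    exact ⟨p, hp', by omega, 0, by rw [← coeff_zero_eq_eval_zero, hc]; exact dvd_zero _⟩
  set c := f.coeff 0 with hcdef
  have hM : (N.factorial : ℤ) ≠ 0 := by exact_mod_cast N.factorial_ne_zero
  have hg1 : f - C c ≠ 0 := by
    intro h
    rw [sub_eq_zero.1 h] at hf; simp at hf
  have hg2 : f + C c ≠ 0 := by
    intro h
    rw [eq_neg_of_add_eq_zero_left h] at hf; simp at hf
  obtain ⟨t, ht⟩ : ∃ t : ℤ, ((f - C c) * (f + C c)).eval (c * N.factorial * t) ≠ 0 := by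
    by_contra! hall
    apply mul_ne_zero hg1 hg2
    apply Polynomial.eq_zero_of_infinite_isRoot
    apply Set.Infinite.mono (s := Set.range (fun t : ℤ => c * N.factorial * t))
    · rintro _ ⟨t, rfl⟩; exact hall t
    · exact Set.infinite_range_of_injective (mul_right_injective₀ (mul_ne_zero hc hM))
  set x := c * N.factorial * t with hx
  have hfx : f.eval x = c * (1 + N.factorial * t * f.divX.eval x) := by
    conv_lhs => rw [← X_mul_divX_add f]
    simp only [eval_add, eval_mul, eval_X, eval_C]
    rw [← hcdef]
    linear_combination (f.divX.eval x) * hx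
  set s := 1 + N.factorial * t * f.divX.eval x with hs
  have hs1 : s.natAbs ≠ 1 := by
    intro h
    apply ht
    simp only [eval_mul, eval_add, eval_sub, eval_C, hfx]
    rcases Int.natAbs_eq_iff.1 h with h | h <;> rw [h] <;> simp
  obtain ⟨p, hp, hps⟩ := Nat.exists_prime_and_dvd hs1
  have hps' : (p : ℤ) ∣ s := Int.natCast_dvd.2 hps
  refine ⟨p, hp, ?_, x, by rw [hfx]; exact hps'.mul_left c⟩
  by_contra! hle
  have h1 : (p : ℤ) ∣ N.factorial := by exact_mod_cast hp.dvd_factorial.2 hle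
  have h2 : (p : ℤ) ∣ 1 := by
    have : (1 : ℤ) = s - N.factorial * t * f.divX.eval x := by rw [hs]; ring
    rw [this]
    exact dvd_sub hps' ((h1.mul_right _).mul_right _)
  have := Int.natCast_dvd.1 h2
  simp at this
  exact hp.one_lt.ne' this

lemma norm_int_eq_one (p : ℕ) [hp : Fact p.Prime] (d : ℤ) (hd : d ≠ 0) (hlt : d.natAbs < p) :
    ‖(d : ℚ_[p])‖ = 1 := by
  refine le_antisymm (Padic.norm_int_le_one d) ?_
  by_contra! h
  rw [Padic.norm_intCast_lt_one_iff] at h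
  have := Nat.le_of_dvd (Int.natAbs_pos.2 hd) (Int.natCast_dvd.1 h)
  omega

lemma exists_padic_emb (K : Type*) [Field K] [CharZero K] [Algebra ℚ K] [FiniteDimensional ℚ K] (N : ℕ) :
    ∃ (p : ℕ) (_ : Fact p.Prime), N < p ∧ Nonempty (K →+* ℚ_[p]) := by
  set pb := Field.powerBasisOfFiniteOfSeparable ℚ K
  set g := minpoly ℚ pb.gen with hg
  have hgirr : Irreducible g := minpoly.irreducible pb.isIntegral_gen
  have hsep : g.Separable := hgirr.separable
  obtain ⟨b, hb, hf⟩ := IsLocalization.integerNormalization_spec (nonZeroDivisors ℤ) g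
  set f := IsLocalization.integerNormalization (nonZeroDivisors ℤ) g
  have hb0 : b ≠ 0 := nonZeroDivisors.ne_zero hb
  have hbQ : (b : ℚ) ≠ 0 := by exact_mod_cast hb0
  have hf' : f.map (algebraMap ℤ ℚ) = C (b : ℚ) * g := by
    rw [hf, zsmul_eq_mul]; simp
  obtain ⟨u, v, huv⟩ := hsep
  obtain ⟨b1, hb1, hU⟩ := IsLocalization.integerNormalization_spec (nonZeroDivisors ℤ) u
  obtain ⟨b2, hb2, hV⟩ := IsLocalization.integerNormalization_spec (nonZeroDivisors ℤ) v
  set U := IsLocalization.integerNormalization (nonZeroDivisors ℤ) u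
  set V := IsLocalization.integerNormalization (nonZeroDivisors ℤ) v
  have hd0 : b * b1 * b2 ≠ 0 := mul_ne_zero (mul_ne_zero hb0 (nonZeroDivisors.ne_zero hb1)) (nonZeroDivisors.ne_zero hb2)
  have bez : C b2 * U * f + C b1 * V * derivative f = C (b * b1 * b2) := by
    apply Polynomial.map_injective (algebraMap ℤ ℚ) Int.cast_injective
    simp only [Polynomial.map_add, Polynomial.map_mul, ← derivative_map, hU, hV, hf', map_C, zsmul_eq_mul, derivative_C_mul]
    simp only [map_mul, eq_intCast, map_intCast]
    linear_combination ((b : ℚ[X]) * b1 * b2) * huv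
  have hfdeg : 0 < f.natDegree := by
    have : (f.map (algebraMap ℤ ℚ)).natDegree = g.natDegree := by
      rw [hf', natDegree_C_mul hbQ]
    rw [natDegree_map_eq_of_injective Int.cast_injective] at this
    rw [this]
    exact hgirr.natDegree_pos
  obtain ⟨p, hp, hNp, x, hx⟩ := exists_prime_root f hfdeg (N + (b * b1 * b2).natAbs)
  have : Fact p.Prime := ⟨hp⟩
  refine ⟨p, ⟨hp⟩, by omega, ?_⟩
  have ev (F : ℤ[X]) : aeval (x : ℤ_[p]) F = ((F.eval x : ℤ) : ℤ_[p]) := by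
    have := aeval_algebraMap_apply ℤ_[p] x F
    simpa using this
  have n0 : ‖aeval (x : ℤ_[p]) f‖ < 1 := by
    rw [ev, PadicInt.norm_lt_one_iff_dvd]
    obtain ⟨c, hc⟩ := hx
    exact ⟨c, by rw [hc]; push_cast; rfl⟩
  have n1 : ‖aeval (x : ℤ_[p]) (derivative f)‖ = 1 := by
    by_contra hne
    have hlt := lt_of_le_of_ne (PadicInt.norm_le_one _) hne
    rw [PadicInt.norm_lt_one_iff_dvd] at hlt n0
    have e := congrArg (aeval (x : ℤ_[p])) bez
    rw [map_add, map_mul, map_mul (aeval (x : ℤ_[p])) _ (derivative f)] at e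
    have h3 : (p : ℤ_[p]) ∣ aeval (x : ℤ_[p]) (C (b * b1 * b2)) := by
      rw [← e]; exact dvd_add (n0.mul_left _) (hlt.mul_left _)
    rw [← PadicInt.norm_lt_one_iff_dvd, aeval_C] at h3
    have h4 := norm_int_eq_one p _ hd0 (by omega)
    rw [PadicInt.norm_def] at h3
    simp only [eq_intCast, PadicInt.coe_intCast] at h3
    rw [h4] at h3
    exact lt_irrefl _ h3
  obtain ⟨z, hz, -⟩ := hensels_lemma (F := f) (a := (x : ℤ_[p])) (by rw [n1]; simpa using n0)
  have hz' : aeval (z : ℚ_[p]) g = 0 := by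
    have h5 : aeval (z : ℚ_[p]) f = 0 := by
      have := aeval_algebraMap_apply ℚ_[p] z f
      rw [hz, map_zero] at this
      exact this
    rw [← aeval_map_algebraMap ℚ, hf', map_mul, aeval_C] at h5
    refine (mul_eq_zero.1 h5).resolve_left ?_
    simpa using hb0
  exact ⟨(pb.lift (z : ℚ_[p]) hz').toRingHom⟩

lemma norm_le_one_of_integral (p : ℕ) [hp : Fact p.Prime] (x : ℚ_[p]) (hx : IsIntegral ℤ x) : ‖x‖ ≤ 1 := by
  have h1 : IsIntegral ℤ_[p] x := hx.tower_top
  obtain ⟨y, rfl⟩ := IsIntegrallyClosed.algebraMap_eq_of_integral h1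
  exact y.2

lemma almost_all_le (K : Type*) [Field K] [CharZero K] [Algebra ℚ K] [FiniteDimensional ℚ K] (a : K) :
    ∃ N : ℕ, ∀ (p : ℕ) [Fact p.Prime], N < p → ∀ ψ : K →+* ℚ_[p], ‖ψ a‖ ≤ 1 := by
  have halg : IsAlgebraic ℤ a := by
    rw [IsFractionRing.isAlgebraic_iff ℤ ℚ K]
    exact Algebra.IsAlgebraic.isAlgebraic a
  obtain ⟨d, hd0, hd⟩ := halg.exists_integral_multiple
  refine ⟨d.natAbs, fun p _ hlt ψ => ?_⟩
  have h1 : IsIntegral ℤ (ψ (d • a)) := hd.map ψ.toIntAlgHom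
  have h2 := norm_le_one_of_integral p _ h1
  rw [map_zsmul, zsmul_eq_mul, norm_mul, norm_int_eq_one p d hd0 hlt, one_mul] at h2
  exact h2

lemma almost_all_unit (K : Type*) [Field K] [CharZero K] [Algebra ℚ K] [FiniteDimensional ℚ K] (a : K) (ha : a ≠ 0) :
    ∃ N : ℕ, ∀ (p : ℕ) [Fact p.Prime], N < p → ∀ ψ : K →+* ℚ_[p], ‖ψ a‖ = 1 := by
  obtain ⟨N1, h1⟩ := almost_all_le K a
  obtain ⟨N2, h2⟩ := almost_all_le K a⁻¹
  refine ⟨max N1 N2, fun p _ hlt ψ => ?_⟩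
  have e1 := h1 p (lt_of_le_of_lt (le_max_left _ _) hlt) ψ
  have e2 := h2 p (lt_of_le_of_lt (le_max_right _ _) hlt) ψ
  have h0 : 0 < ‖ψ a‖ := norm_pos_iff.2 ((map_ne_zero ψ).2 ha)
  rw [map_inv₀, norm_inv] at e2
  exact le_antisymm e1 ((inv_le_one₀ h0).1 e2)
end PartD
section PartE
open Polynomial

lemma minpoly_eq_h (p : ℕ) [hp : Fact p.Prime] (hp2 : p ≠ 2) (h : ℤ[X]) (hmon : h.Monic) (hdeg : h.natDegree = p - 1)
    (hmod : h.map (Int.castRingHom (ZMod p)) = X ^ (p-1)) (h0 : h.coeff 0 = p ∨ h.coeff 0 = -p)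
    (K : IntermediateField ℚ ℂ) (ψ : K →+* ℚ_[p]) (θ : ℂ) (hθ : aeval θ h = 0) :
    minpoly K θ = h.map (Int.castRingHom K) := by
  have hirr : Irreducible (h.map (Int.castRingHom K)) := by
    apply (hmon.map _).irreducible_of_irreducible_map ψ
    rw [Polynomial.map_map, RingHom.ext_int (ψ.comp (Int.castRingHom K)) (Int.castRingHom ℚ_[p])]
    exact h_irred p hp2 h hmon hdeg hmod h0
  symm
  apply minpoly.eq_of_irreducible_of_monic hirr _ (hmon.map _)
  rw [← hθ]
  exact aeval_map_algebraMap K θ h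

lemma isIntegral_h (h : ℤ[X]) (hmon : h.Monic) (K : IntermediateField ℚ ℂ) (θ : ℂ) (hθ : aeval θ h = 0) :
    IsIntegral K θ := by
  have : IsIntegral ℤ θ := ⟨h, hmon, hθ⟩
  exact this.tower_top

/-- Adjoining an element, as an intermediate field over the rationals. -/
noncomputable def adj (K : IntermediateField ℚ ℂ) (θ : ℂ) : IntermediateField ℚ ℂ :=
  (IntermediateField.adjoin K {θ}).restrictScalars ℚ

lemma le_adj (K : IntermediateField ℚ ℂ) (θ : ℂ) : K ≤ adj K θ := by
  intro x hx
  exact (IntermediateField.adjoin K {θ}).algebraMap_mem ⟨x, hx⟩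

lemma mem_adj (K : IntermediateField ℚ ℂ) (θ : ℂ) : θ ∈ adj K θ :=
  IntermediateField.mem_adjoin_simple_self K θ

lemma adj_le (K M : IntermediateField ℚ ℂ) (θ : ℂ) (hK : K ≤ M) (hθ : θ ∈ M) : adj K θ ≤ M := by
  intro x hx
  have hx' : x ∈ IntermediateField.adjoin K {θ} := hx
  induction hx' using IntermediateField.adjoin_induction with
  | mem x hx1 => rw [Set.mem_singleton_iff.1 hx1]; exact hθ
  | algebraMap x => exact hK x.2
  | add x y hx1 hy1 h1 h2 => exact add_mem (h1 hx1) (h2 hy1)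
  | inv x hx1 h1 => exact inv_mem (h1 hx1)
  | mul x y hx1 hy1 h1 h2 => exact mul_mem (h1 hx1) (h2 hy1)

lemma alg_eq (K : IntermediateField ℚ ℂ) (θ : ℂ) (hle : K ≤ adj K θ) :
    (IntermediateField.inclusion hle).toRingHom.toAlgebra =
      (inferInstance : Algebra K (IntermediateField.adjoin K {θ})) := by
  apply Algebra.algebra_ext
  intro r
  rfl

lemma finrank_incl (K L : IntermediateField ℚ ℂ) (hle : K ≤ L) :
    Module.finrank ℚ L = Module.finrank ℚ K *
      (letI : Algebra K L := (IntermediateField.inclusion hle).toRingHom.toAlgebra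
       Module.finrank K L) := by
  letI : Algebra K L := (IntermediateField.inclusion hle).toRingHom.toAlgebra
  have : IsScalarTower ℚ K L := IsScalarTower.of_algebraMap_eq fun x => rfl
  exact (Module.finrank_mul_finrank ℚ K L).symm

lemma finrank_adj (p : ℕ) (h : ℤ[X]) (hmon : h.Monic) (hdeg : h.natDegree = p - 1)
    (K : IntermediateField ℚ ℂ) (θ : ℂ) (hθ : aeval θ h = 0)
    (hm : minpoly K θ = h.map (Int.castRingHom K)) :
    Module.finrank ℚ (adj K θ) = Module.finrank ℚ K * (p - 1) := by
  have h1 := IntermediateField.adjoin.finrank (isIntegral_h h hmon K θ hθ)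
  rw [hm, hmon.natDegree_map, hdeg] at h1
  rw [← h1]
  exact (Module.finrank_mul_finrank ℚ K (IntermediateField.adjoin K {θ})).symm

lemma fd_adj (K : IntermediateField ℚ ℂ) [FiniteDimensional ℚ K] (θ : ℂ) (hθ : IsIntegral K θ) :
    FiniteDimensional ℚ (adj K θ) := by
  have := IntermediateField.adjoin.finiteDimensional hθ
  exact Module.Finite.trans (R := ℚ) K (IntermediateField.adjoin K {θ})

lemma isCM_adj (p : ℕ) [hp : Fact p.Prime] (hp2 : p ≠ 2) (h : ℤ[X]) (hmon : h.Monic) (hdeg : h.natDegree = p - 1)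
    (hmod : h.map (Int.castRingHom (ZMod p)) = X ^ (p-1)) (h0 : h.coeff 0 = p ∨ h.coeff 0 = -p)
    (hreal : ∀ z : ℂ, aeval z h = 0 → z.im = 0)
    (K : IntermediateField ℚ ℂ) [FiniteDimensional ℚ K] (hK : IsCM K) (ψ : K →+* ℚ_[p])
    (θ : ℂ) (hθ : aeval θ h = 0) : IsCM (adj K θ) := by
  obtain ⟨him, Kp, hle, hTR, h2⟩ := hK
  have hle' : adj Kp θ ≤ adj K θ := adj_le Kp _ θ (hle.trans (le_adj K θ)) (mem_adj K θ)
  refine ⟨?_, adj Kp θ, hle', ?_, ?_⟩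
  · intro φ
    obtain ⟨x, hx⟩ := him (φ.comp (IntermediateField.inclusion (le_adj K θ)).toRingHom)
    exact ⟨_, hx⟩
  · intro φ x
    obtain ⟨x, hx⟩ := x
    have hx' : x ∈ IntermediateField.adjoin Kp {θ} := hx
    induction hx' using IntermediateField.adjoin_induction with
    | mem x hx1 =>
      have hxθ := Set.mem_singleton_iff.1 hx1
      subst hxθ
      apply hreal
      have e1 : aeval (⟨x, hx⟩ : adj Kp x) h = 0 := by
        apply Subtype.val_injective
        have := aeval_algebraMap_apply ℂ (⟨x, hx⟩ : adj Kp x) h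
        exact this.symm.trans hθ
      have := aeval_algHom_apply φ.toIntAlgHom (⟨x, hx⟩ : adj Kp x) h
      rw [e1, map_zero] at this
      exact this
    | algebraMap x => exact hTR (φ.comp (IntermediateField.inclusion (le_adj Kp θ)).toRingHom) x
    | add x y hx1 hy1 h1 h3 =>
      have := congrArg Complex.im (map_add φ (⟨x, hx1⟩ : adj Kp θ) ⟨y, hy1⟩)
      rw [Complex.add_im, h1 hx1, h3 hy1, add_zero] at this
      exact this
    | inv x hx1 h1 =>
      have := congrArg Complex.im (map_inv₀ φ (⟨x, hx1⟩ : adj Kp θ))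
      rw [Complex.inv_im, h1 hx1, neg_zero, zero_div] at this
      exact this
    | mul x y hx1 hy1 h1 h3 =>
      have := congrArg Complex.im (map_mul φ (⟨x, hx1⟩ : adj Kp θ) ⟨y, hy1⟩)
      rw [Complex.mul_im, h1 hx1, h3 hy1, mul_zero, zero_mul, add_zero] at this
      exact this
  · have e1 := finrank_incl Kp K hle
    have e2 := finrank_incl (adj Kp θ) (adj K θ) hle'
    have m1 := minpoly_eq_h p hp2 h hmon hdeg hmod h0 K ψ θ hθ
    have m2 := minpoly_eq_h p hp2 h hmon hdeg hmod h0 Kp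
      (ψ.comp (IntermediateField.inclusion hle).toRingHom) θ hθ
    have f1 := finrank_adj p h hmon hdeg K θ hθ m1
    have f2 := finrank_adj p h hmon hdeg Kp θ hθ m2
    have hpos : 0 < Module.finrank ℚ K := Module.finrank_pos
    have hp1 : 0 < p - 1 := by have := hp.out.two_le; omega
    rw [f1, f2, e1] at e2
    rw [h2] at e1 e2
    have hkp : 0 < Module.finrank ℚ Kp := by omega
    have : 0 < Module.finrank ℚ Kp * (p-1) := Nat.mul_pos hkp hp1
    apply Nat.eq_of_mul_eq_mul_left this
    rw [← e2]; ring
end PartE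

/-- A norm-compatible family of nonzero elements `a_K ∈ K^×`, indexed by
the CM subfields `K` of `ℂ` of finite degree over `ℚ`, is trivial: `a_K = 1` for
every `K`. -/
theorem stmt_11 (a : ∀ K : IntermediateField ℚ ℂ, K)
    (ha : ∀ (K : IntermediateField ℚ ℂ) [FiniteDimensional ℚ K],
      IsCM K → a K ≠ 0)
    (hcompat : ∀ (K L : IntermediateField ℚ ℂ)
      [FiniteDimensional ℚ K] [FiniteDimensional ℚ L],
      IsCM K → IsCM L → ∀ h : K ≤ L, fieldNorm K L h (a L) = a K) :
    ∀ (K : IntermediateField ℚ ℂ) [FiniteDimensional ℚ K], IsCM K → a K = 1 := by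
  intro K _ hK
  by_contra hne
  obtain ⟨N1, h1⟩ := almost_all_unit K (a K) (ha K hK)
  obtain ⟨N2, h2⟩ := almost_all_unit K (a K - 1) (sub_ne_zero.2 hne)
  obtain ⟨p, hp, hlt, ⟨ψ⟩⟩ := exists_padic_emb K (N1 + N2 + 2)
  have hp2 : p ≠ 2 := by omega
  have n1 := h1 p (by omega) ψ
  have n2 := h2 p (by omega) ψ
  obtain ⟨h, hmon, hdeg, hmod, h0, hreal⟩ := exists_h p hp2
  obtain ⟨θ, hθ⟩ : ∃ θ : ℂ, Polynomial.aeval θ h = 0 := by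
    apply IsAlgClosed.exists_aeval_eq_zero_of_injective ℂ (algebraMap ℤ ℂ).injective_int
    intro hd
    have hd' : h.natDegree = 0 := Polynomial.natDegree_eq_of_degree_eq_some hd
    omega
  have hthInt := isIntegral_h h hmon K θ hθ
  have := fd_adj K θ hthInt
  have hCM := isCM_adj p hp2 h hmon hdeg hmod h0 hreal K hK ψ θ hθ
  have hc := hcompat K (adj K θ) hK hCM (le_adj K θ)
  have hc' : @Algebra.norm K (IntermediateField.adjoin K {θ}) _ _ inferInstance (a (adj K θ)) = a K := by
    rw [← hc]
    unfold fieldNorm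
    rw [alg_eq K θ (le_adj K θ)]
    rfl
  have hmp := minpoly_eq_h p hp2 h hmon hdeg hmod h0 K ψ θ hθ
  have key := norm_congr_one p hp2 h hmon hdeg hmod h0 (IntermediateField.adjoin.powerBasis hthInt)
    (by rw [IntermediateField.adjoin.powerBasis_gen, IntermediateField.minpoly_gen, hmp]) ψ (a (adj K θ))
  rw [hc'] at key
  have k2 := key n1
  rw [map_sub, map_one] at n2
  rw [n2] at k2
  exact lt_irrefl _ k2
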